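/- arXiv:2105.05677 — 6 statements merged into one kernel-verified Lean document; each statement's English description precedes it below -/
import Mathlib

section
/- For all z, y ∈ ℝ, the supremum sup{ a·z + b·y : (a,b) ∈ ℝ², a + b²/2 ≤ 0 }, computed in the extended reals, equals y²/(2z) if z > 0; equals 0 if z = 0 and y = 0; and equals +∞ otherwise (i.e. if z < 0, or if z = 0 and y ≠ 0). -/
open scoped Classical

/-- For all `z, y ∈ ℝ`, the supremum (in the extended reals) of
`a·z + b·y` over the set `K₂ = {(a,b) : a + b²/2 ≤ 0}` equals `y²/(2z)` if `z > 0`,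
equals `0` if `z = 0` and `y = 0`, and equals `+∞` otherwise. -/
theorem sup_over_K2_eq (z y : ℝ) :
    (⨆ p : {p : ℝ × ℝ // p.1 + p.2 ^ 2 / 2 ≤ 0},
        ((p.1.1 * z + p.1.2 * y : ℝ) : EReal)) =
      if 0 < z then ((y ^ 2 / (2 * z) : ℝ) : EReal)
      else if z = 0 ∧ y = 0 then (0 : EReal)
      else (⊤ : EReal) := by
  split_ifs with hz h0
  · apply le_antisymm
    · refine iSup_le fun ⟨⟨a, b⟩, h⟩ => EReal.coe_le_coe_iff.2 ?_
      dsimp only at h ⊢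
      rw [le_div_iff₀ (by positivity)]
      nlinarith [sq_nonneg (b * z - y), mul_le_mul_of_nonneg_right h (sq_nonneg z)]
    · refine le_iSup_of_le ⟨(-(y / z) ^ 2 / 2, y / z), by dsimp only; linarith⟩
        (EReal.coe_le_coe_iff.2 (le_of_eq ?_))
      dsimp only
      field_simp
      ring
  · obtain ⟨rfl, rfl⟩ := h0
    have : Nonempty {p : ℝ × ℝ // p.1 + p.2 ^ 2 / 2 ≤ 0} := ⟨⟨(0, 0), by norm_num⟩⟩
    simp
  · refine (EReal.eq_top_iff_forall_lt _).2 fun M => ?_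
    have hM : M < |M| + 1 := by linarith [le_abs_self M]
    rcases (not_lt.1 hz).lt_or_eq with hz | rfl
    · have hnn : 0 ≤ (|M| + 1) / -z := div_nonneg (by positivity) (by linarith)
      refine lt_iSup_iff.2 ⟨⟨(-((|M| + 1) / -z), 0), by dsimp only; linarith⟩,
        EReal.coe_lt_coe_iff.2 (hM.trans_eq ?_)⟩
      have := hz.ne
      dsimp only
      field_simp
      ring
    · have hy : y ≠ 0 := fun hy => h0 ⟨rfl, hy⟩
      refine lt_iSup_iff.2 ⟨⟨(-((|M| + 1) / y) ^ 2 / 2, (|M| + 1) / y), by dsimp only; linarith⟩,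
        EReal.coe_lt_coe_iff.2 (hM.trans_eq ?_)⟩
      dsimp only
      field_simp
      ring
end

section
/- Let (X,d) be a compact metric space and let μ and J be finite signed Borel measures on X. Then B₂(μ,J) equals the supremum, over all bounded Borel measurable functions a, b : X → ℝ satisfying a(x) + b(x)²/2 ≤ 0 for all x ∈ X, of ∫_X a dμ + ∫_X b dJ, the equality holding in ℝ ∪ {+∞}. -/
open MeasureTheory

/-- Integration of a real-valued function against a finite signed Borel measure,
defined as the difference of the integrals against the positive and negative
parts of its Jordan decomposition. -/
noncomputable def signedIntegral {X : Type*} [MeasurableSpace X]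
    (μ : SignedMeasure X) (f : X → ℝ) : ℝ :=
  ∫ x, f x ∂μ.toJordanDecomposition.posPart - ∫ x, f x ∂μ.toJordanDecomposition.negPart

/-- The Benamou–Brenier functional: the supremum, over all pairs of continuous
functions `a b : X → ℝ` with `a x + (b x)²/2 ≤ 0` everywhere, of
`∫ a dμ + ∫ b dJ`, computed in the extended reals. -/
noncomputable def BB2 {X : Type*} [MeasurableSpace X] [TopologicalSpace X]
    (μ J : SignedMeasure X) : EReal :=
  ⨆ p : {p : C(X, ℝ) × C(X, ℝ) // ∀ x, p.1 x + (p.2 x) ^ 2 / 2 ≤ 0},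
    ((signedIntegral μ p.1.1 + signedIntegral J p.1.2 : ℝ) : EReal)

/-- Integrals against a signed measure differ by at most the `L¹` distance of the integrands with
respect to any measure dominating the total variation. -/
lemma abs_signedIntegral_sub_le {X : Type*} [MeasurableSpace X] (μ : SignedMeasure X)
    {ν : Measure X} (hν : μ.totalVariation ≤ ν) {f g : X → ℝ}
    (hf : Integrable f ν) (hg : Integrable g ν) :
    |signedIntegral μ f - signedIntegral μ g| ≤ ∫ x, |f x - g x| ∂ν := by
  have hp : μ.toJordanDecomposition.posPart ≤ ν := le_trans (Measure.le_add_right le_rfl) hν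
  have hn : μ.toJordanDecomposition.negPart ≤ ν := le_trans (Measure.le_add_left le_rfl) hν
  have hd : Integrable (fun x => |f x - g x|) ν := (hf.sub hg).abs
  calc |signedIntegral μ f - signedIntegral μ g|
      = |∫ x, (f x - g x) ∂μ.toJordanDecomposition.posPart
          - ∫ x, (f x - g x) ∂μ.toJordanDecomposition.negPart| := by
        rw [integral_sub (hf.mono_measure hp) (hg.mono_measure hp),
          integral_sub (hf.mono_measure hn) (hg.mono_measure hn)]
        unfold signedIntegral
        congr 1
        ring
    _ ≤ |∫ x, (f x - g x) ∂μ.toJordanDecomposition.posPart|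
          + |∫ x, (f x - g x) ∂μ.toJordanDecomposition.negPart| := abs_sub _ _
    _ ≤ ∫ x, |f x - g x| ∂μ.toJordanDecomposition.posPart
          + ∫ x, |f x - g x| ∂μ.toJordanDecomposition.negPart :=
        add_le_add (abs_integral_le_integral_abs) (abs_integral_le_integral_abs)
    _ = ∫ x, |f x - g x| ∂μ.totalVariation :=
        (integral_add_measure (hd.mono_measure hp) (hd.mono_measure hn)).symm
    _ ≤ ∫ x, |f x - g x| ∂ν :=
        integral_mono_measure hν (Filter.Eventually.of_forall fun x => abs_nonneg _) hd

/-- Truncating a pair `(g, h)` to satisfy `a + b² / 2 ≤ 0` and `|b| ≤ C` moves it away from an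
admissible pair `(a, b)` by an amount controlled by the original distance. -/
lemma abs_truncate_sub_le {a b g h C : ℝ} (hC : |b| ≤ C) (hab : a + b ^ 2 / 2 ≤ 0) :
    |max (-C) (min C h) - b| ≤ |h - b| ∧
      |min g (-(max (-C) (min C h)) ^ 2 / 2) - a| ≤ |g - a| + C * |h - b| := by
  obtain ⟨h1, h2⟩ := abs_le.mp hC
  have hC0 : 0 ≤ C := (abs_nonneg b).trans hC
  set k := max (-C) (min C h) with hk
  have hkb : |k - b| ≤ |h - b| := by
    have e : b = max (-C) (min C b) := by rw [min_eq_right h2, max_eq_right h1]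
    conv_lhs => rw [e]
    exact (abs_max_sub_max_le_max _ _ _ _).trans (max_le (by simp)
      ((abs_min_sub_min_le_max _ _ _ _).trans (max_le (by simp) le_rfl)))
  refine ⟨hkb, ?_⟩
  have hkC : |k| ≤ C := abs_le.mpr ⟨le_max_left _ _, max_le (by linarith) (min_le_left _ _)⟩
  have hsq : |k ^ 2 - b ^ 2| ≤ 2 * C * |h - b| := by
    rw [sq_sub_sq, abs_mul]
    exact mul_le_mul ((abs_add_le _ _).trans (by linarith)) hkb (abs_nonneg _) (by linarith)
  have h3 := abs_le.mp hsq
  have h4 := neg_abs_le (g - a)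
  have h5 := le_abs_self (g - a)
  have h6 : 0 ≤ C * |h - b| := mul_nonneg hC0 (abs_nonneg _)
  rw [abs_le]
  constructor
  · have : a - |g - a| - C * |h - b| ≤ min g (-k ^ 2 / 2) := le_min (by linarith) (by
      linarith [abs_nonneg (g - a)])
    linarith
  · linarith [min_le_left g (-k ^ 2 / 2)]

/-- An admissible bounded measurable pair can be approximated by admissible continuous pairs
in `L¹` of a finite Borel measure. -/
lemma exists_continuous_admissible_integral_sub_le {X : Type*} [MetricSpace X]
    [MeasurableSpace X] [BorelSpace X] (ν : Measure X) [IsFiniteMeasure ν]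
    {a b : X → ℝ} (ha : Integrable a ν) (hb : Integrable b ν) {C : ℝ}
    (hC : ∀ x, |b x| ≤ C) (hab : ∀ x, a x + (b x) ^ 2 / 2 ≤ 0) {ε : ℝ} (hε : 0 < ε) :
    ∃ f k : C(X, ℝ), Integrable f ν ∧ Integrable k ν ∧ (∀ x, f x + (k x) ^ 2 / 2 ≤ 0) ∧
      ∫ x, |f x - a x| ∂ν ≤ ε ∧ ∫ x, |k x - b x| ∂ν ≤ ε := by
  rcases isEmpty_or_nonempty X with hX | ⟨⟨x₀⟩⟩
  · have hν : ν = 0 := Measure.eq_zero_of_isEmpty ν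
    subst hν
    exact ⟨0, 0, by simp, by simp, fun x => isEmptyElim x, by simp [hε.le], by simp [hε.le]⟩
  have hC0 : 0 ≤ C := (abs_nonneg _).trans (hC x₀)
  set δ := ε / (1 + C) with hδ
  have hδ0 : 0 < δ := by positivity
  have hδε : δ + C * δ = ε := by rw [hδ]; field_simp
  obtain ⟨g, hg, hgi⟩ := ha.exists_boundedContinuous_integral_sub_le hδ0
  obtain ⟨h, hh, hhi⟩ := hb.exists_boundedContinuous_integral_sub_le hδ0
  have hga : Integrable (fun x => |g x - a x|) ν := (hgi.sub ha).abs
  have hhb : Integrable (fun x => |h x - b x|) ν := (hhi.sub hb).abs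
  have hg' : ∫ x, |g x - a x| ∂ν ≤ δ := by
    simpa only [Real.norm_eq_abs, abs_sub_comm] using hg
  have hh' : ∫ x, |h x - b x| ∂ν ≤ δ := by
    simpa only [Real.norm_eq_abs, abs_sub_comm] using hh
  let k : C(X, ℝ) := ⟨fun x => max (-C) (min C (h x)), by fun_prop⟩
  let f : C(X, ℝ) := ⟨fun x => min (g x) (-(max (-C) (min C (h x))) ^ 2 / 2), by fun_prop⟩
  have hk x : |k x - b x| ≤ |h x - b x| :=
    (abs_truncate_sub_le (g := g x) (h := h x) (hC x) (hab x)).1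
  have hf x : |f x - a x| ≤ |g x - a x| + C * |h x - b x| :=
    (abs_truncate_sub_le (g := g x) (h := h x) (hC x) (hab x)).2
  have hbound := hga.add (hhb.const_mul C)
  have hkb : Integrable (fun x => k x - b x) ν :=
    hhb.mono' (k.continuous.aestronglyMeasurable.sub hb.1) (Filter.Eventually.of_forall hk)
  have hfa : Integrable (fun x => f x - a x) ν :=
    hbound.mono' (f.continuous.aestronglyMeasurable.sub ha.1) (Filter.Eventually.of_forall hf)
  refine ⟨f, k, ?_, ?_, fun x => ?_, ?_, ?_⟩
  · exact (hfa.add ha).congr (Filter.Eventually.of_forall fun x => sub_add_cancel _ _)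
  · exact (hkb.add hb).congr (Filter.Eventually.of_forall fun x => sub_add_cancel _ _)
  · have : f x ≤ -(k x) ^ 2 / 2 := min_le_right _ _
    linarith
  · calc ∫ x, |f x - a x| ∂ν ≤ ∫ x, (|g x - a x| + C * |h x - b x|) ∂ν :=
          integral_mono hfa.abs hbound hf
      _ = ∫ x, |g x - a x| ∂ν + C * ∫ x, |h x - b x| ∂ν := by
          rw [integral_add hga (hhb.const_mul C), integral_const_mul]
      _ ≤ δ + C * δ := by gcongr
      _ = ε := hδε
  · calc ∫ x, |k x - b x| ∂ν ≤ ∫ x, |h x - b x| ∂ν := integral_mono hkb.abs hhb hk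
      _ ≤ ε := by nlinarith

/-- On a compact metric space, the Benamou–Brenier functional
equals the supremum over all pairs of *bounded Borel measurable* functions
`a, b : X → ℝ` with `a x + (b x)²/2 ≤ 0` everywhere of `∫ a dμ + ∫ b dJ`. -/
theorem BB2_eq_sup_boundedMeasurable {X : Type*} [MetricSpace X] [CompactSpace X]
    [MeasurableSpace X] [BorelSpace X] (μ J : SignedMeasure X) :
    BB2 μ J =
      ⨆ p : {p : (X → ℝ) × (X → ℝ) //
          Measurable p.1 ∧ Measurable p.2 ∧
          (∃ C : ℝ, ∀ x, |p.1 x| ≤ C) ∧ (∃ C : ℝ, ∀ x, |p.2 x| ≤ C) ∧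
          ∀ x, p.1 x + (p.2 x) ^ 2 / 2 ≤ 0},
        ((signedIntegral μ p.1.1 + signedIntegral J p.1.2 : ℝ) : EReal) := by
  apply le_antisymm
  · refine iSup_le fun ⟨⟨f, k⟩, hfk⟩ => ?_
    have hbdd (u : C(X, ℝ)) : ∃ C : ℝ, ∀ x, |u x| ≤ C := ⟨‖u‖, u.norm_coe_le_norm⟩
    exact le_iSup_of_le ⟨(⇑f, ⇑k), f.continuous.measurable, k.continuous.measurable,
      hbdd f, hbdd k, hfk⟩ le_rfl
  · refine iSup_le fun ⟨⟨a, b⟩, ha, hb, ⟨A, hA⟩, ⟨C, hC⟩, hab⟩ => ?_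
    rw [← EReal.ge_of_forall_gt_iff_ge]
    intro z hz
    dsimp only at ha hb hA hC hab hz
    have hz' := sub_pos.mpr (EReal.coe_lt_coe_iff.mp hz)
    have : IsFiniteMeasure μ.totalVariation := by
      unfold SignedMeasure.totalVariation; infer_instance
    have : IsFiniteMeasure J.totalVariation := by
      unfold SignedMeasure.totalVariation; infer_instance
    let ν := μ.totalVariation + J.totalVariation
    have hai : Integrable a ν :=
      Integrable.of_bound ha.aestronglyMeasurable A (Filter.Eventually.of_forall hA)
    have hbi : Integrable b ν :=
      Integrable.of_bound hb.aestronglyMeasurable C (Filter.Eventually.of_forall hC)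
    obtain ⟨f, k, hfi, hki, hfk, hfa, hkb⟩ :=
      exists_continuous_admissible_integral_sub_le ν hai hbi hC hab (half_pos hz')
    refine le_iSup_of_le ⟨(f, k), hfk⟩ (EReal.coe_le_coe_iff.mpr ?_)
    have h1 := (abs_signedIntegral_sub_le μ (Measure.le_add_right le_rfl) hfi hai).trans hfa
    have h2 := (abs_signedIntegral_sub_le J (Measure.le_add_left le_rfl) hki hbi).trans hkb
    rw [abs_le] at h1 h2
    dsimp only
    linarith
end

section
/- Let (X,d) be a compact metric space, let μ be a finite (nonnegative) Borel measure on X, and let v : X → ℝ be Borel measurable with ∫_X v² dμ < ∞. Let J be the finite signed Borel measure with density v with respect to μ (so J(A) = ∫_A v dμ for every Borel set A). Then B₂(μ,J) = (1/2) ∫_X v² dμ. -/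
open MeasureTheory

/-- The signed integral against a difference of finite measures is the difference of the integrals,
whether or not the two measures are mutually singular. -/
theorem signedIntegral_eq_integral_sub_integral {X : Type*} [MeasurableSpace X]
    {s : SignedMeasure X} {μ ν : Measure X} [IsFiniteMeasure μ] [IsFiniteMeasure ν]
    (hs : s = μ.toSignedMeasure - ν.toSignedMeasure) {f : X → ℝ}
    (hf : ∀ (ρ : Measure X) [IsFiniteMeasure ρ], Integrable f ρ) :
    signedIntegral s f = ∫ x, f x ∂μ - ∫ x, f x ∂ν := by
  set j := s.toJordanDecomposition with hj
  have hjs : j.posPart.toSignedMeasure - j.negPart.toSignedMeasure =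
      μ.toSignedMeasure - ν.toSignedMeasure :=
    s.toSignedMeasure_toJordanDecomposition.trans hs
  have hadd : j.posPart + ν = μ + j.negPart := by
    rw [← Measure.toSignedMeasure_eq_toSignedMeasure_iff, Measure.toSignedMeasure_add,
      Measure.toSignedMeasure_add]
    exact sub_eq_sub_iff_add_eq_add.mp hjs
  have hint := congrArg (fun ρ : Measure X => ∫ x, f x ∂ρ) hadd
  simp only [integral_add_measure (hf _) (hf _)] at hint
  rw [signedIntegral, ← hj]
  linarith

theorem signedIntegral_toSignedMeasure {X : Type*} [MeasurableSpace X]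
    (μ : Measure X) [IsFiniteMeasure μ] {f : X → ℝ}
    (hf : ∀ (ρ : Measure X) [IsFiniteMeasure ρ], Integrable f ρ) :
    signedIntegral μ.toSignedMeasure f = ∫ x, f x ∂μ := by
  rw [signedIntegral_eq_integral_sub_integral (μ := μ) (ν := 0) (by simp) hf]
  simp

theorem signedIntegral_withDensityᵥ {X : Type*} [MeasurableSpace X]
    {μ : Measure X} {v : X → ℝ} (hv : Integrable v μ) {f : X → ℝ}
    (hf : ∀ (ρ : Measure X) [IsFiniteMeasure ρ], Integrable f ρ) :
    signedIntegral (μ.withDensityᵥ v) f = ∫ x, f x * v x ∂μ := by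
  have := isFiniteMeasure_withDensity_ofReal hv.2
  have := isFiniteMeasure_withDensity_ofReal hv.neg.2
  have hpos : AEMeasurable (fun x => ENNReal.ofReal (v x)) μ := hv.aemeasurable.ennreal_ofReal
  have hneg : AEMeasurable (fun x => ENNReal.ofReal (-v x)) μ :=
    hv.aemeasurable.neg.ennreal_ofReal
  have hposInt := (integrable_withDensity_iff_integrable_smul₀' hpos
    (by simp)).mp (hf (μ.withDensity fun x => ENNReal.ofReal (v x)))
  have hnegInt := (integrable_withDensity_iff_integrable_smul₀' hneg
    (by simp)).mp (hf (μ.withDensity fun x => ENNReal.ofReal (-v x)))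
  rw [signedIntegral_eq_integral_sub_integral
      (withDensityᵥ_eq_withDensity_pos_part_sub_withDensity_neg_part hv) hf,
    integral_withDensity_eq_integral_toReal_smul₀ hpos (by simp),
    integral_withDensity_eq_integral_toReal_smul₀ hneg (by simp),
    ← integral_sub hposInt hnegInt]
  refine integral_congr_ae (Filter.Eventually.of_forall fun x => ?_)
  simp only [smul_eq_mul, ENNReal.toReal_ofReal']
  rw [← sub_mul, max_zero_sub_max_neg_zero_eq_self, mul_comm]

theorem integral_mul_sub_half_sq {X : Type*} [MeasurableSpace X] {μ : Measure X} {v b : X → ℝ}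
    (hv : MemLp v 2 μ) (hb : MemLp b 2 μ) :
    ∫ x, b x * v x ∂μ - ∫ x, b x ^ 2 / 2 ∂μ =
      1 / 2 * ∫ x, v x ^ 2 ∂μ - 1 / 2 * ∫ x, (v x - b x) ^ 2 ∂μ := by
  have hbv : Integrable (fun x => b x * v x) μ := hb.integrable_mul hv
  have hvb : Integrable (fun x => (v x - b x) ^ 2) μ := (hv.sub hb).integrable_sq
  rw [← integral_const_mul, ← integral_const_mul, ← integral_sub hbv (hb.integrable_sq.div_const 2),
    ← integral_sub (hv.integrable_sq.const_mul _) (hvb.const_mul _)]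
  exact integral_congr_ae (Filter.Eventually.of_forall fun x => by ring)

/-- If `μ` is a finite (nonnegative) Borel measure on a compact
metric space `X`, `v : X → ℝ` is Borel measurable with `∫ v² dμ < ∞`, and `J` is
the signed measure with density `v` with respect to `μ`, then
`B₂(μ, J) = (1/2) ∫ v² dμ`. -/
theorem BB2_of_density {X : Type*} [MetricSpace X] [CompactSpace X]
    [MeasurableSpace X] [BorelSpace X]
    (μ : Measure X) [IsFiniteMeasure μ] (v : X → ℝ) (hv : Measurable v)
    (hv2 : Integrable (fun x => (v x) ^ 2) μ) :
    BB2 μ.toSignedMeasure (μ.withDensityᵥ v) =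
      ((1 / 2 * ∫ x, (v x) ^ 2 ∂μ : ℝ) : EReal) := by
  have hvL : MemLp v 2 μ := (memLp_two_iff_integrable_sq hv.aestronglyMeasurable).mpr hv2
  have hvI : Integrable v μ := hvL.integrable one_le_two
  have hcont (f : C(X, ℝ)) (ρ : Measure X) [IsFiniteMeasure ρ] : Integrable f ρ :=
    f.continuous.integrable_of_hasCompactSupport (HasCompactSupport.of_compactSpace f)
  have hcontL (f : C(X, ℝ)) : MemLp f 2 μ :=
    (memLp_two_iff_integrable_sq f.continuous.aestronglyMeasurable).mpr (hcont (f ^ 2) μ)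
  have hval (a b : C(X, ℝ)) : signedIntegral μ.toSignedMeasure a +
      signedIntegral (μ.withDensityᵥ v) b = ∫ x, a x ∂μ + ∫ x, b x * v x ∂μ := by
    rw [signedIntegral_toSignedMeasure μ (hcont a), signedIntegral_withDensityᵥ hvI (hcont b)]
  apply le_antisymm
  · refine iSup_le fun ⟨⟨a, b⟩, hab⟩ => EReal.coe_le_coe_iff.mpr ((hval a b).trans_le ?_)
    have ha : ∫ x, a x ∂μ ≤ -∫ x, b x ^ 2 / 2 ∂μ := by
      rw [← integral_neg]
      exact integral_mono (hcont a μ) ((hcontL b).integrable_sq.div_const 2).neg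
        fun x => le_neg_iff_add_nonpos_right.mpr (hab x)
    have hsq : 0 ≤ ∫ x, (v x - b x) ^ 2 ∂μ := integral_nonneg fun x => sq_nonneg _
    linarith [integral_mul_sub_half_sq hvL (hcontL b)]
  · refine EReal.ge_of_forall_gt_iff_ge.mp fun r hr => ?_
    have hr' : r < 1 / 2 * ∫ x, v x ^ 2 ∂μ := EReal.coe_lt_coe_iff.mp hr
    obtain ⟨g, hg, -⟩ := MemLp.exists_boundedContinuous_integral_rpow_sub_le (p := 2) two_pos
      (by simpa using hvL) (sub_pos.mpr hr')
    let b : C(X, ℝ) := g.toContinuousMap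
    let a : C(X, ℝ) := ⟨fun x => -(b x ^ 2 / 2), by fun_prop⟩
    have hdist : ∫ x, (v x - b x) ^ 2 ∂μ ≤ 1 / 2 * ∫ x, v x ^ 2 ∂μ - r := by
      simpa [b] using hg
    have hsq : 0 ≤ ∫ x, (v x - b x) ^ 2 ∂μ := integral_nonneg fun x => sq_nonneg _
    refine le_iSup_of_le ⟨(a, b), fun x => by simp [a]⟩ (EReal.coe_le_coe_iff.mpr ?_)
    have ha : ∫ x, a x ∂μ = -∫ x, b x ^ 2 / 2 ∂μ := integral_neg _
    refine le_of_le_of_eq ?_ (hval a b).symm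
    linarith [integral_mul_sub_half_sq hvL (hcontL b)]
end

section
/- Let (X,d) be a nonempty metric space, let L ≥ 0, let f : X → ℝ be Lipschitz with constant L, and let t > 0. Then for all x, y ∈ X one has Q_t f(x) − Q_t f(y) ≤ (d(x,y)/(2t))·(d(x,y) + 4tL). -/
/-- The Hopf–Lax semigroup: `Q_t f (x) = inf_{y ∈ X} (f y + d(x,y)²/(2t))`. -/
noncomputable def hopfLax {X : Type*} [MetricSpace X] (t : ℝ) (f : X → ℝ) (x : X) : ℝ :=
  ⨅ y : X, (f y + dist x y ^ 2 / (2 * t))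

/-- The infimum defining `hopfLax t f x` is over a set bounded below when `f` is Lipschitz. -/
theorem bddBelow_range_hopfLax {X : Type*} [MetricSpace X] {L t : ℝ} (ht : 0 < t) {f : X → ℝ}
    (hf : ∀ x y, |f x - f y| ≤ L * dist x y) (x : X) :
    BddBelow (Set.range fun y : X => f y + dist x y ^ 2 / (2 * t)) := by
  refine ⟨f x - t * L ^ 2 / 2, ?_⟩
  rintro _ ⟨y, rfl⟩
  have hxy := (abs_le.mp (hf x y)).2
  have hsq : L * dist x y - t * L ^ 2 / 2 ≤ dist x y ^ 2 / (2 * t) := by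
    rw [le_div_iff₀ (by positivity)]
    nlinarith [sq_nonneg (dist x y - t * L)]
  dsimp only
  linarith

/-- For an `L`-Lipschitz function `f` and `t > 0`, the Hopf–Lax
semigroup satisfies `Q_t f (x) − Q_t f (y) ≤ (d(x,y)/(2t))·(d(x,y) + 4tL)`. -/
theorem hopfLax_sub_le {X : Type*} [MetricSpace X] [Nonempty X]
    (L t : ℝ) (hL : 0 ≤ L) (ht : 0 < t) (f : X → ℝ)
    (hf : ∀ x y, |f x - f y| ≤ L * dist x y) (x y : X) :
    hopfLax t f x - hopfLax t f y ≤ dist x y / (2 * t) * (dist x y + 4 * t * L) := by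
  have hle (z : X) : hopfLax t f x ≤ f z + dist x z ^ 2 / (2 * t) :=
    ciInf_le (bddBelow_range_hopfLax ht hf x) z
  have hrhs : dist x y / (2 * t) * (dist x y + 4 * t * L) =
      dist x y ^ 2 / (2 * t) + 2 * L * dist x y := by
    field_simp
    ring
  rw [hrhs, sub_le_comm]
  refine le_ciInf fun z => ?_
  have hd : 0 ≤ dist x y := dist_nonneg
  have hr : 0 ≤ dist y z := dist_nonneg
  rcases le_total (dist y z) (2 * t * L) with h | h
  · have hsq : dist x z ^ 2 / (2 * t) ≤
        dist x y ^ 2 / (2 * t) + 2 * L * dist x y + dist y z ^ 2 / (2 * t) := by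
      have htri : dist x z ^ 2 ≤ (dist x y + dist y z) ^ 2 := by
        gcongr
        exact dist_triangle x y z
      have hexp : dist x y ^ 2 / (2 * t) + 2 * L * dist x y + dist y z ^ 2 / (2 * t) =
          (dist x y ^ 2 + 2 * dist x y * (2 * t * L) + dist y z ^ 2) / (2 * t) := by
        field_simp
      rw [hexp]
      gcongr
      nlinarith [mul_le_mul_of_nonneg_left h hd]
    linarith [hle z]
  · have hyz := (abs_le.mp (hf y z)).2
    have hlin : L * dist y z ≤ dist y z ^ 2 / (2 * t) := by
      rw [le_div_iff₀ (by positivity)]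
      nlinarith [mul_le_mul_of_nonneg_left h hr]
    have hLd : 0 ≤ L * dist x y := mul_nonneg hL hd
    linarith [hle y]
end

section
/- Let (X,d) be a compact metric space and ν a Borel probability measure on X. For each n ∈ ℕ let σₙ be a Borel probability measure on X × X whose second marginal (pushforward under (x,y) ↦ y) equals ν, and suppose ∫_{X×X} d(x,y)² dσₙ(x,y) → 0 as n → ∞. Then σₙ converges weakly to the diagonal coupling (Id,Id)_#ν, i.e. for every continuous f : X × X → ℝ one has ∫_{X×X} f dσₙ → ∫_X f(x,x) dν(x). -/
open MeasureTheory Filter Topology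

/-- On a compact metric space, the deviation of a continuous function from its value on the
diagonal is bounded by an arbitrarily small constant plus a multiple of the squared distance. -/
theorem ContinuousMap.exists_abs_sub_diagonal_le {X : Type*} [MetricSpace X] [CompactSpace X]
    (f : C(X × X, ℝ)) {ε : ℝ} (hε : 0 < ε) :
    ∃ C : ℝ, ∀ p : X × X, |f p - f (p.2, p.2)| ≤ ε + C * dist p.1 p.2 ^ 2 := by
  obtain ⟨δ, hδ, h⟩ := Metric.uniformContinuous_iff.1
    (CompactSpace.uniformContinuous_of_continuous f.continuous) ε hε
  refine ⟨2 * ‖f‖ / δ ^ 2, fun p => ?_⟩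
  rcases lt_or_ge (dist p.1 p.2) δ with hp | hp
  · have hd : dist p (p.2, p.2) < δ := by simpa [Prod.dist_eq, hδ] using hp
    have hf : |f p - f (p.2, p.2)| < ε := h hd
    have : 0 ≤ 2 * ‖f‖ / δ ^ 2 * dist p.1 p.2 ^ 2 := by positivity
    linarith
  · have hf : |f p - f (p.2, p.2)| ≤ 2 * ‖f‖ := by
      have h₁ := f.norm_coe_le_norm p
      have h₂ := f.norm_coe_le_norm (p.2, p.2)
      have h₃ := norm_sub_le (f p) (f (p.2, p.2))
      rw [Real.norm_eq_abs (f p - f (p.2, p.2))] at h₃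
      linarith
    have hle : 2 * ‖f‖ ≤ 2 * ‖f‖ / δ ^ 2 * dist p.1 p.2 ^ 2 := by
      calc 2 * ‖f‖ = 2 * ‖f‖ / δ ^ 2 * δ ^ 2 := by field_simp
        _ ≤ 2 * ‖f‖ / δ ^ 2 * dist p.1 p.2 ^ 2 := by gcongr
    linarith

/-- If `σₙ` are Borel probability measures on `X × X` whose
second marginal is `ν` and `∫ d(x,y)² dσₙ → 0`, then `σₙ` converges weakly to the
diagonal coupling `(Id,Id)_# ν`: for every continuous `f : X × X → ℝ`,
`∫ f dσₙ → ∫ f(x,x) dν(x)`. -/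
theorem tendsto_diagonal_coupling {X : Type*} [MetricSpace X] [CompactSpace X]
    [MeasurableSpace X] [BorelSpace X]
    (ν : Measure X) [IsProbabilityMeasure ν]
    (σ : ℕ → Measure (X × X)) (hprob : ∀ n, IsProbabilityMeasure (σ n))
    (hsnd : ∀ n, (σ n).map Prod.snd = ν)
    (hcost : Tendsto (fun n => ∫ p, dist p.1 p.2 ^ 2 ∂(σ n)) atTop (𝓝 0)) :
    ∀ f : C(X × X, ℝ),
      Tendsto (fun n => ∫ p, f p ∂(σ n)) atTop (𝓝 (∫ x, f (x, x) ∂ν)) := by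
  intro f
  have hint : ∀ (n : ℕ) {g : X × X → ℝ}, Continuous g → Integrable g (σ n) := fun n g hg =>
    hg.integrable_of_hasCompactSupport (HasCompactSupport.of_compactSpace g)
  have hdiag : ∀ n, ∫ x, f (x, x) ∂ν = ∫ p, f (p.2, p.2) ∂(σ n) := fun n => by
    have hc : Continuous fun x : X => f (x, x) := by fun_prop
    rw [← hsnd n, integral_map measurable_snd.aemeasurable hc.aestronglyMeasurable]
  rw [Metric.tendsto_atTop']
  intro ε hε
  obtain ⟨C, hC⟩ := f.exists_abs_sub_diagonal_le (half_pos hε)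
  have hlim : Tendsto (fun n => ε / 2 + C * ∫ p, dist p.1 p.2 ^ 2 ∂(σ n)) atTop (𝓝 (ε / 2)) := by
    simpa using (hcost.const_mul C).const_add (ε / 2)
  obtain ⟨N, hN⟩ := eventually_atTop.1 (hlim.eventually_lt_const (half_lt_self hε))
  refine ⟨N, fun n hn => lt_of_le_of_lt ?_ (hN n hn.le)⟩
  rw [hdiag n, Real.dist_eq, ← integral_sub (hint n (by fun_prop)) (hint n (by fun_prop))]
  calc |∫ p, (f p - f (p.2, p.2)) ∂(σ n)|
      ≤ ∫ p, |f p - f (p.2, p.2)| ∂(σ n) := abs_integral_le_integral_abs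
    _ ≤ ∫ p, (ε / 2 + C * dist p.1 p.2 ^ 2) ∂(σ n) :=
        integral_mono (hint n (by fun_prop)) (hint n (by fun_prop)) hC
    _ = ε / 2 + C * ∫ p, dist p.1 p.2 ^ 2 ∂(σ n) := by
        rw [integral_add (hint n (by fun_prop)) (hint n (by fun_prop)), integral_const_mul]
        simp
end

section
/- Let μ be a Borel probability measure on ℝ and let v : ℝ → ℝ be Borel measurable with ∫_ℝ v² dμ < ∞. Let κ_ε denote the uniform probability measure on [−ε,ε] for ε > 0. Define the regularised measure μᵉ := μ ∗ κ_ε (convolution of measures) and the regularised signed momentum Jᵉ := (v⁺μ) ∗ κ_ε − (v⁻μ) ∗ κ_ε, where v⁺, v⁻ are the positive and negative parts of v and v⁺μ, v⁻μ denote the measures with these densities with respect to μ. Then Jᵉ is absolutely continuous with respect to μᵉ, and its Radon–Nikodym density vᵉ := dJᵉ/dμᵉ satisfies the kinetic energy contraction ∫_ℝ (vᵉ)² dμᵉ ≤ ∫_ℝ v² dμ. -/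
open MeasureTheory

/-- Convolution of two finite Borel measures on `ℝ`: the pushforward of the
product measure under addition. -/
noncomputable def measConv (μ κ : Measure ℝ) : Measure ℝ :=
  (μ.prod κ).map (fun p : ℝ × ℝ => p.1 + p.2)

/-- The uniform probability measure on `[-ε, ε]`. -/
noncomputable def unifIcc (ε : ℝ) : Measure ℝ :=
  (ENNReal.ofReal (2 * ε))⁻¹ • (volume.restrict (Set.Icc (-ε) ε))

/-- The conditional expectation of a square-integrable function `f` given a random variable `T`,
seen as a function on the codomain of `T`, together with its `L²` contraction property. -/
theorem exists_condExp_factor {Ω E : Type*} [MeasurableSpace Ω] [mE : MeasurableSpace E]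
    (P : Measure Ω) [IsFiniteMeasure P] {T : Ω → E} (hT : Measurable T) {f : Ω → ℝ}
    (hf : MemLp f 2 P) :
    ∃ g : E → ℝ, Measurable g ∧ Integrable g (P.map T) ∧
      (∀ A, MeasurableSet A → ∫ x in A, g x ∂(P.map T) = ∫ ω in T ⁻¹' A, f ω ∂P) ∧
      ∫ x, g x ^ 2 ∂(P.map T) ≤ ∫ ω, f ω ^ 2 ∂P := by
  have hm := hT.comap_le
  set m := mE.comap T
  obtain ⟨g, hg, hgT⟩ :=
    (stronglyMeasurable_condExp (f := f) (m := m) (μ := P)).exists_eq_measurable_comp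
  have hg' : Measurable g := hg.measurable
  refine ⟨g, hg', ?_, fun A hA => ?_, ?_⟩
  · rw [integrable_map_measure hg'.aestronglyMeasurable hT.aemeasurable, ← hgT]
    exact integrable_condExp
  · rw [setIntegral_map hA hg'.aestronglyMeasurable hT.aemeasurable,
      ← setIntegral_condExp hm (hf.integrable one_le_two) ⟨A, hA, rfl⟩, hgT]
    rfl
  · rw [integral_map hT.aemeasurable (hg'.pow_const 2).aestronglyMeasurable]
    change ∫ ω, ((g ∘ T) ω) ^ 2 ∂P ≤ _
    rw [← hgT, ← integral_condExp hm (f := fun ω => f ω ^ 2)]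
    refine integral_mono_ae (hf.condExp one_le_two).integrable_sq integrable_condExp ?_
    have hvar : 0 ≤ᵐ[P] ProbabilityTheory.condVar m f P :=
      condExp_nonneg (ae_of_all _ fun ω => sq_nonneg _)
    filter_upwards [ProbabilityTheory.condVar_ae_eq_condExp_sq_sub_sq_condExp hm hf, hvar]
      with ω h h0
    rw [h] at h0
    exact sub_nonneg.1 h0

theorem isProbabilityMeasure_unifIcc {ε : ℝ} (hε : 0 < ε) : IsProbabilityMeasure (unifIcc ε) := by
  constructor
  rw [unifIcc, Measure.smul_apply, Measure.restrict_apply_univ, Real.volume_Icc, sub_neg_eq_add,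
    ← two_mul, smul_eq_mul]
  exact ENNReal.inv_mul_cancel (by simpa using hε) ENNReal.ofReal_ne_top

theorem measConv_withDensity_apply {μ κ : Measure ℝ} [SFinite μ] [SFinite κ]
    {w : ℝ → ENNReal} (hw : Measurable w) {A : Set ℝ} (hA : MeasurableSet A) :
    measConv (μ.withDensity w) κ A =
      ∫⁻ p in (fun p : ℝ × ℝ => p.1 + p.2) ⁻¹' A, w p.1 ∂(μ.prod κ) := by
  have hT : Measurable fun p : ℝ × ℝ => p.1 + p.2 := by fun_prop
  rw [measConv, Measure.map_apply hT hA, prod_withDensity_left hw,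
    withDensity_apply _ (hT hA)]

/-- Let `μ` be a Borel probability measure on `ℝ` and
`v : ℝ → ℝ` Borel measurable with `∫ v² dμ < ∞`. With `κ_ε` the uniform
probability measure on `[-ε,ε]`, set `μᵉ := μ ∗ κ_ε` and
`Jᵉ := (v⁺μ) ∗ κ_ε − (v⁻μ) ∗ κ_ε`. Then `Jᵉ` is absolutely continuous with
respect to `μᵉ`, with a density `vᵉ` (`Jᵉ(A) = ∫_A vᵉ dμᵉ` for all Borel `A`)
satisfying the kinetic energy contraction `∫ (vᵉ)² dμᵉ ≤ ∫ v² dμ`. -/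
theorem regularised_momentum_energy_contraction
    (μ : Measure ℝ) [IsProbabilityMeasure μ] (v : ℝ → ℝ) (hv : Measurable v)
    (hv2 : Integrable (fun x => (v x) ^ 2) μ) (ε : ℝ) (hε : 0 < ε) :
    ∃ ve : ℝ → ℝ, Measurable ve ∧
      Integrable ve (measConv μ (unifIcc ε)) ∧
      (∀ A : Set ℝ, MeasurableSet A →
        measConv μ (unifIcc ε) A = 0 →
          measConv (μ.withDensity fun x => ENNReal.ofReal (v x)) (unifIcc ε) A =
            measConv (μ.withDensity fun x => ENNReal.ofReal (-(v x))) (unifIcc ε) A) ∧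
      (∀ A : Set ℝ, MeasurableSet A →
        (measConv (μ.withDensity fun x => ENNReal.ofReal (v x)) (unifIcc ε) A).toReal -
          (measConv (μ.withDensity fun x => ENNReal.ofReal (-(v x))) (unifIcc ε) A).toReal =
          ∫ x in A, ve x ∂(measConv μ (unifIcc ε))) ∧
      ∫ x, (ve x) ^ 2 ∂(measConv μ (unifIcc ε)) ≤ ∫ x, (v x) ^ 2 ∂μ := by
  have := isProbabilityMeasure_unifIcc hε
  have hT : Measurable fun p : ℝ × ℝ => p.1 + p.2 := by fun_prop
  have hL2 : MemLp (fun p : ℝ × ℝ => v p.1) 2 (μ.prod (unifIcc ε)) :=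
    ((memLp_two_iff_integrable_sq hv.aestronglyMeasurable).2 hv2).comp_fst _
  have hpos : Measurable fun x => ENNReal.ofReal (v x) := hv.ennreal_ofReal
  have hneg : Measurable fun x => ENNReal.ofReal (-(v x)) := hv.neg.ennreal_ofReal
  obtain ⟨g, hg, hgi, hgA, hg2⟩ := exists_condExp_factor (μ.prod (unifIcc ε)) hT hL2
  refine ⟨g, hg, hgi, fun A hA h0 => ?_, fun A hA => ?_, ?_⟩
  · rw [measConv, Measure.map_apply hT hA] at h0
    rw [measConv_withDensity_apply hpos hA, measConv_withDensity_apply hneg hA,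
      setLIntegral_measure_zero _ _ h0, setLIntegral_measure_zero _ _ h0]
  · rw [measConv_withDensity_apply hpos hA, measConv_withDensity_apply hneg hA]
    exact (integral_eq_lintegral_pos_part_sub_lintegral_neg_part
      (hL2.integrable one_le_two).integrableOn).symm.trans (hgA A hA).symm
  · refine hg2.trans_eq ?_
    rw [integral_fun_fst (fun x => v x ^ 2)]
    simp
end
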